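/- Let d_x, n ∈ ℕ, γ ∈ (0,1], K_H > 0, p ∈ [1,∞) and ε ∈ (0,1). For every function F: [0,1]^{d_x×n} → ℝ^{d_x×n} such that each entry function F_{i,j} belongs to the Hölder class H^γ([0,1]^{d_x×n}, K_H), there exists a generalized Transformer network N of the form N = E_out ∘ G_L^{FF} ∘ G_L^{SA} ∘ … ∘ G_1^{FF} ∘ G_1^{SA} ∘ E_in with embedding dimension D = 4 d_x n, L = 6⌈(1/γ)·log₂(1/ε)⌉ layers, each G_l^{SA} a column-averaging attention layer whose projection matrix has rank at most S = d_x, and each G_l^{FF} a generalized feed-forward layer with hidden dimension W = 3 d_x n·⌈ε^{−d_x n/γ}⌉, such that ‖N − F‖_{L^p} ≤ 4 (d_x n)^3 K_H ε. -/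

import Mathlib

open MeasureTheory Matrix

noncomputable section

/-- The column-wise softmax `σ_S`. -/
noncomputable def softmaxCol {d n : ℕ} (A : Matrix (Fin d) (Fin n) ℝ) :
    Matrix (Fin d) (Fin n) ℝ :=
  Matrix.of fun i j => Real.exp (A i j) / ∑ k, Real.exp (A k j)

/-- The entrywise ReLU `σ_R`. -/
def reluM {d n : ℕ} (A : Matrix (Fin d) (Fin n) ℝ) : Matrix (Fin d) (Fin n) ℝ :=
  Matrix.of fun i j => max (A i j) 0

/-- A self-attention layer with `H` heads of head size `S` on `ℝ^{D×n}`. -/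
def IsSelfAttn (n D H S : ℕ)
    (f : Matrix (Fin D) (Fin n) ℝ → Matrix (Fin D) (Fin n) ℝ) : Prop :=
  ∃ (WV WK WQ : Fin H → Matrix (Fin S) (Fin D) ℝ)
    (WO : Fin H → Matrix (Fin D) (Fin S) ℝ),
    ∀ Z, f Z = Z + ∑ h, WO h * ((WV h * Z) * softmaxCol ((WK h * Z)ᵀ * (WQ h * Z)))

/-- A feed-forward layer with hidden dimension `W` on `ℝ^{D×n}`. -/
def IsFeedForward (n D W : ℕ)
    (f : Matrix (Fin D) (Fin n) ℝ → Matrix (Fin D) (Fin n) ℝ) : Prop :=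
  ∃ (W1 : Matrix (Fin W) (Fin D) ℝ) (W2 : Matrix (Fin D) (Fin W) ℝ)
    (b1 : Fin W → ℝ) (b2 : Fin D → ℝ),
    ∀ Z, f Z = Z + W2 * reluM (W1 * Z + Matrix.of fun i _ => b1 i) +
      Matrix.of fun i _ => b2 i

/-- Membership in the transformer class `T_{dx,dy}(D,H,S,W,L)` with sequence length `n`. -/
def IsTransformer (n dx dy D H S W L : ℕ)
    (f : Matrix (Fin dx) (Fin n) ℝ → Matrix (Fin dy) (Fin n) ℝ) : Prop :=
  ∃ (Ain : Matrix (Fin D) (Fin dx) ℝ) (P : Matrix (Fin D) (Fin n) ℝ)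
    (Aout : Matrix (Fin dy) (Fin D) ℝ)
    (SA FF : Fin L → Matrix (Fin D) (Fin n) ℝ → Matrix (Fin D) (Fin n) ℝ),
    (∀ l, IsSelfAttn n D H S (SA l)) ∧ (∀ l, IsFeedForward n D W (FF l)) ∧
    ∀ X, f X = Aout * Fin.foldl L (fun Z l => FF l (SA l Z)) (Ain * X + P)

/-- The Frobenius norm of a real matrix. -/
noncomputable def frobNorm {d n : ℕ} (A : Matrix (Fin d) (Fin n) ℝ) : ℝ :=
  Real.sqrt (∑ i, ∑ j, (A i j) ^ 2)

/-- The unit cube `[0,1]^{d×n}` of matrices. -/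
def unitCube (d n : ℕ) : Set (Matrix (Fin d) (Fin n) ℝ) :=
  {X | ∀ i j, X i j ∈ Set.Icc (0 : ℝ) 1}

/-- The Hölder class `H^γ(Ω, K)`: the sum of the sup-norm and the `γ`-Hölder seminorm
(w.r.t. the Frobenius norm) is at most `K`. -/
def HolderClass {d n : ℕ} (γ K : ℝ) (Ω : Set (Matrix (Fin d) (Fin n) ℝ))
    (f : Matrix (Fin d) (Fin n) ℝ → ℝ) : Prop :=
  ∃ C1 C2 : ℝ, 0 ≤ C1 ∧ 0 ≤ C2 ∧ C1 + C2 ≤ K ∧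
    (∀ X ∈ Ω, |f X| ≤ C1) ∧
    ∀ X ∈ Ω, ∀ Y ∈ Ω, |f X - f Y| ≤ C2 * frobNorm (X - Y) ^ γ

noncomputable instance matrixMeasureSpace {d n : ℕ} :
    MeasureSpace (Matrix (Fin d) (Fin n) ℝ) :=
  inferInstanceAs (MeasureSpace (Fin d → Fin n → ℝ))

/-- The `L^p` norm over the unit cube of a matrix-valued map, measured in Frobenius norm. -/
noncomputable def lpNormCube {d n : ℕ} (p : ℝ)
    (G : Matrix (Fin d) (Fin n) ℝ → Matrix (Fin d) (Fin n) ℝ) : ℝ :=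
  (∫ X in unitCube d n, frobNorm (G X) ^ p) ^ (1 / p)

end

/-- A generalized feed-forward layer with hidden dimension `W` on `ℝ^{D×n}`:
the biases are allowed to differ across columns. -/
def IsGenFeedForward (n D W : ℕ)
    (f : Matrix (Fin D) (Fin n) ℝ → Matrix (Fin D) (Fin n) ℝ) : Prop :=
  ∃ (W1 : Matrix (Fin W) (Fin D) ℝ) (W2 : Matrix (Fin D) (Fin W) ℝ)
    (B1 : Matrix (Fin W) (Fin n) ℝ) (B2 : Matrix (Fin D) (Fin n) ℝ),
    ∀ Z, f Z = Z + W2 * reluM (W1 * Z + B1) + B2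

/-- A column-averaging attention layer on `ℝ^{D×n}` whose projection matrix has rank
at most `S`: `Z ↦ Z + W^O ⬝ A(Z)` where every column of `A(Z)` is the column average of `Z`. -/
def IsColAvgAttn (n D S : ℕ)
    (f : Matrix (Fin D) (Fin n) ℝ → Matrix (Fin D) (Fin n) ℝ) : Prop :=
  ∃ WO : Matrix (Fin D) (Fin D) ℝ, WO.rank ≤ S ∧
    ∀ Z, f Z = Z + WO * Matrix.of fun i (_ : Fin n) => (∑ j, Z i j) / n

/-- The generalized transformer class: embedding, then `L` pairs of a column-averaging
attention layer and a generalized feed-forward layer, then projection. -/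
def IsGenTransformer (n dx D S W L : ℕ)
    (f : Matrix (Fin dx) (Fin n) ℝ → Matrix (Fin dx) (Fin n) ℝ) : Prop :=
  ∃ (Ain : Matrix (Fin D) (Fin dx) ℝ) (P : Matrix (Fin D) (Fin n) ℝ)
    (Aout : Matrix (Fin dx) (Fin D) ℝ)
    (SA FF : Fin L → Matrix (Fin D) (Fin n) ℝ → Matrix (Fin D) (Fin n) ℝ),
    (∀ l, IsColAvgAttn n D S (SA l)) ∧ (∀ l, IsGenFeedForward n D W (FF l)) ∧
    ∀ X, f X = Aout * Fin.foldl L (fun Z l => FF l (SA l Z)) (Ain * X + P)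


/-- Hat function built from three ReLUs. -/
noncomputable def hatF (u : ℝ) : ℝ := max (u + 1) 0 - 2 * max u 0 + max (u - 1) 0

/-- Ramp function built from two ReLUs. -/
noncomputable def rampF (u : ℝ) : ℝ := max u 0 - max (u - 1) 0

lemma hatF_mem (u : ℝ) : 0 ≤ hatF u ∧ hatF u ≤ 1 := by
  unfold hatF
  rcases max_cases (u + 1) 0 with h | h <;> rcases max_cases u 0 with h' | h' <;>
    rcases max_cases (u - 1) 0 with h'' | h'' <;> constructor <;> linarith

lemma rampF_mem (u : ℝ) : 0 ≤ rampF u ∧ rampF u ≤ 1 := by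
  unfold rampF
  rcases max_cases u 0 with h' | h' <;>
    rcases max_cases (u - 1) 0 with h'' | h'' <;> constructor <;> linarith

lemma rampF_one {u : ℝ} (h : 1 ≤ u) : rampF u = 1 := by
  unfold rampF
  rw [max_eq_left (by linarith), max_eq_left (by linarith)]; ring

lemma rampF_zero {u : ℝ} (h : u ≤ 0) : rampF u = 0 := by
  unfold rampF
  rw [max_eq_right (by linarith), max_eq_right (by linarith)]; ring

lemma hatF_nat (a b : ℕ) : hatF ((a : ℝ) - b) = if a = b then 1 else 0 := by
  unfold hatF
  rcases lt_trichotomy a b with h | h | h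
  · have h1 : (a : ℝ) + 1 ≤ b := by exact_mod_cast h
    rw [if_neg h.ne, max_eq_right (by linarith), max_eq_right (by linarith),
      max_eq_right (by linarith)]; ring
  · subst h; simp
  · have h1 : (b : ℝ) + 1 ≤ a := by exact_mod_cast h
    rw [if_neg h.ne', max_eq_left (by linarith), max_eq_left (by linarith),
      max_eq_left (by linarith)]; ring

/-- Feed-forward layers with an arbitrary finite hidden index type. -/
lemma genFF_of {n D W : ℕ} {H : Type} [Fintype H] [DecidableEq H] (hW : Fintype.card H ≤ W)
    (α : H → ℝ) (r : H → Fin D) (b : H → Fin n → ℝ) (w : Fin D → H → ℝ)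
    (f : Matrix (Fin D) (Fin n) ℝ → Matrix (Fin D) (Fin n) ℝ)
    (hf : ∀ Z k j, f Z k j = Z k j + ∑ h, w k h * max (α h * Z (r h) j + b h j) 0) :
    IsGenFeedForward n D W f := by
  have hc : Fintype.card (H ⊕ Fin (W - Fintype.card H)) = W := by
    simp; omega
  let e : Fin W ≃ H ⊕ Fin (W - Fintype.card H) := (Fintype.equivFinOfCardEq hc).symm
  refine ⟨Matrix.of fun x k => Sum.elim (fun h => if k = r h then α h else 0) (fun _ => 0) (e x),
    Matrix.of fun k x => Sum.elim (fun h => w k h) (fun _ => 0) (e x),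
    Matrix.of fun x j => Sum.elim (fun h => b h j) (fun _ => 0) (e x), 0, ?_⟩
  intro Z
  ext k j
  rw [hf]
  simp only [Matrix.add_apply, Matrix.mul_apply, reluM, Matrix.of_apply, Matrix.zero_apply,
    add_zero]
  congr 1
  rw [← e.symm.sum_comp]
  simp [Fintype.sum_sum_type]

lemma colAvg_of {n D S : ℕ} (hn : 0 < n) (hS : 1 ≤ S) (s c : Fin D)
    (f : Matrix (Fin D) (Fin n) ℝ → Matrix (Fin D) (Fin n) ℝ)
    (hf : ∀ Z k j, f Z k j = Z k j + if k = s then ∑ j', Z c j' else 0) :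
    IsColAvgAttn n D S f := by
  refine ⟨Matrix.vecMulVec (Pi.single s (n : ℝ)) (Pi.single c 1),
    (Matrix.rank_vecMulVec_le _ _).trans hS, ?_⟩
  intro Z
  ext k j
  rw [hf]
  simp only [Matrix.add_apply, Matrix.mul_apply, Matrix.of_apply, Matrix.vecMulVec_apply]
  congr 1
  have : (n : ℝ) ≠ 0 := by positivity
  rw [Finset.sum_eq_single c]
  · by_cases h : k = s
    · subst h; simp; field_simp
    · simp [h]
  · intro b _ hb; simp [hb]
  · simp

lemma foldl_id {L : ℕ} {α : Type} (f : α → Fin L → α) (hf : ∀ z l, f z l = z) (z : α) :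
    Fin.foldl L f z = z := by
  induction L generalizing z with
  | zero => simp
  | succ L ih => rw [Fin.foldl_succ, hf]; exact ih _ (fun z l => hf z _) z

/-- The scalar code of the network. -/
noncomputable def codeF (dx n M : ℕ) (δ : ℝ) (X : Matrix (Fin dx) (Fin n) ℝ) : ℝ :=
  ∑ j, ∑ i, (M : ℝ) ^ ((finProdFinEquiv (i, j) : Fin (dx * n)) : ℕ) *
    ∑ t : Fin M, rampF ((X i j - ((t : ℕ) + 1) / M) / δ)

lemma net_form (dx n D W L M : ℕ) (hdx : 0 < dx) (hn : 0 < n) (hD : 2 * dx + 2 ≤ D)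
    (hL : 2 ≤ L) (hW1 : 2 * dx * n * M ≤ W) (hW2 : 3 * n * M ^ (dx * n) ≤ W)
    (δ : ℝ) (hδ : 0 < δ) (val : Fin (M ^ (dx * n)) → Fin dx → Fin n → ℝ) :
    ∃ N : Matrix (Fin dx) (Fin n) ℝ → Matrix (Fin dx) (Fin n) ℝ,
      IsGenTransformer n dx D dx W L N ∧ ∀ X ∈ unitCube dx n, ∀ i j,
        N X i j = ∑ a, val a i j * hatF (codeF dx n M δ X - (a : ℕ)) := by
  classical
  obtain ⟨L, rfl⟩ : ∃ L', L = L' + 2 := ⟨L - 2, by omega⟩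
  let xr : Fin dx → Fin D := fun i => ⟨i, by omega⟩
  let orr : Fin dx → Fin D := fun i => ⟨dx + i, by omega⟩
  let c : Fin D := ⟨2 * dx, by omega⟩
  let s : Fin D := ⟨2 * dx + 1, by omega⟩
  have hxx : ∀ i i', xr i = xr i' ↔ i = i' := by
    intro i i'; simp [xr, Fin.ext_iff]
  have hoo : ∀ i i', orr i = orr i' ↔ i = i' := by
    intro i i'; simp [orr, Fin.ext_iff]
  have hox : ∀ i i', orr i ≠ xr i' := by
    intro i i'; simp [orr, xr, Fin.ext_iff]; omega
  have hoc : ∀ i, orr i ≠ c := by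
    intro i; simp [orr, c, Fin.ext_iff]; omega
  have hos : ∀ i, orr i ≠ s := by
    intro i; simp [orr, s, Fin.ext_iff]; omega
  have hcx : ∀ i, c ≠ xr i := by
    intro i; simp [c, xr, Fin.ext_iff]; omega
  have hsx : ∀ i, s ≠ xr i := by
    intro i; simp [s, xr, Fin.ext_iff]; omega
  have hsc : s ≠ c := by simp [s, c, Fin.ext_iff]
  have hcs : c ≠ s := by simp [s, c, Fin.ext_iff]
  -- first layer
  let B1 : ℝ := 1 / δ + 1
  let ff1 : Matrix (Fin D) (Fin n) ℝ → Matrix (Fin D) (Fin n) ℝ := fun Z k j =>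
    Z k j + ∑ h : Fin dx × Fin n × Fin M × Fin 2,
      (if k = c then (M : ℝ) ^ ((finProdFinEquiv (h.1, h.2.1) : Fin (dx * n)) : ℕ) *
        (![1, -1] : Fin 2 → ℝ) h.2.2.2 else 0) *
      max (δ⁻¹ * Z (xr h.1) j + (-(((h.2.2.1 : ℕ) : ℝ) + 1) / M / δ
        - (![0, 1] : Fin 2 → ℝ) h.2.2.2 - if j = h.2.1 then 0 else B1)) 0
  have hff1 : IsGenFeedForward n D W ff1 := by
    refine genFF_of (H := Fin dx × Fin n × Fin M × Fin 2) (by simp; linarith) (fun _ => δ⁻¹)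
      (fun h => xr h.1) (fun h j => _) (fun k h => _) ff1 (fun Z k j => rfl)
  let sa : Matrix (Fin D) (Fin n) ℝ → Matrix (Fin D) (Fin n) ℝ := fun Z k j =>
    Z k j + if k = s then ∑ j', Z c j' else 0
  have hsa : IsColAvgAttn n D dx sa := colAvg_of hn hdx s c sa (fun Z k j => rfl)
  let B2 : ℝ := (∑ j : Fin n, ∑ i : Fin dx,
    (M : ℝ) ^ ((finProdFinEquiv (i, j) : Fin (dx * n)) : ℕ) * M) + 1
  let ff2 : Matrix (Fin D) (Fin n) ℝ → Matrix (Fin D) (Fin n) ℝ := fun Z k j =>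
    Z k j + ∑ h : Fin n × Fin (M ^ (dx * n)) × Fin 3,
      ((∑ i, if k = orr i then val h.2.1 i h.1 else 0) * (![1, -2, 1] : Fin 3 → ℝ) h.2.2) *
      max (1 * Z s j + (-((h.2.1 : ℕ) : ℝ)
        + (![1, 0, -1] : Fin 3 → ℝ) h.2.2 - if j = h.1 then 0 else B2)) 0
  have hff2 : IsGenFeedForward n D W ff2 := by
    refine genFF_of (H := Fin n × Fin (M ^ (dx * n)) × Fin 3) (by simp; linarith) (fun _ => 1)
      (fun h => s) (fun h j => _) (fun k h => _) ff2 (fun Z k j => rfl)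
  have hidS : IsColAvgAttn n D dx id := ⟨0, by simp, by simp⟩
  have hidF : IsGenFeedForward n D W id := ⟨0, 0, 0, 0, by simp⟩
  let Ain : Matrix (Fin D) (Fin dx) ℝ := Matrix.of fun k i => if k = xr i then 1 else 0
  let Aout : Matrix (Fin dx) (Fin D) ℝ := Matrix.of fun i k => if k = orr i then 1 else 0
  refine ⟨fun X => Aout * ff2 (sa (ff1 (Ain * X))), ⟨Ain, 0, Aout,
    fun l => if (l : ℕ) = 1 then sa else id,
    fun l => if (l : ℕ) = 0 then ff1 else if (l : ℕ) = 1 then ff2 else id, ?_, ?_, ?_⟩, ?_⟩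
  · intro l; dsimp only; split_ifs <;> assumption
  · intro l; dsimp only; split_ifs <;> assumption
  · intro X
    rw [Fin.foldl_succ, Fin.foldl_succ, foldl_id]
    · simp
    · intro z l; simp
  · intro X hX i j
    have hZx : ∀ i j, (Ain * X) (xr i) j = X i j := by
      intro i j
      simp [Matrix.mul_apply, Ain, hxx]
    have hZo : ∀ i j, (Ain * X) (orr i) j = 0 := by
      intro i j
      simp [Matrix.mul_apply, Ain, hox]
    have hZc : ∀ j, (Ain * X) c j = 0 := by
      intro j
      simp [Matrix.mul_apply, Ain, hcx]
    have hZs : ∀ j, (Ain * X) s j = 0 := by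
      intro j
      simp [Matrix.mul_apply, Ain, hsx]
    have h1o : ∀ i j, ff1 (Ain * X) (orr i) j = 0 := by
      intro i j
      simp [ff1, hZo, hoc]
    have h1s : ∀ j, ff1 (Ain * X) s j = 0 := by
      intro j
      simp [ff1, hZs, hsc]
    have h1c : ∀ j, ff1 (Ain * X) c j =
        ∑ i, (M : ℝ) ^ ((finProdFinEquiv (i, j) : Fin (dx * n)) : ℕ) *
          ∑ t : Fin M, rampF ((X i j - ((t : ℕ) + 1) / M) / δ) := by
      intro j
      simp only [ff1, hZc, hZx, if_true, zero_add, Fintype.sum_prod_type]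
      refine Finset.sum_congr rfl fun i _ => ?_
      rw [Finset.sum_eq_single j]
      · rw [Finset.mul_sum]
        refine Finset.sum_congr rfl fun t _ => ?_
        simp only [Fin.sum_univ_two, if_true, rampF]
        simp
        rw [show δ⁻¹ * X i j + (-1 + -(t : ℝ)) / M / δ = (X i j - (t + 1) / M) / δ by ring,
          show δ⁻¹ * X i j + ((-1 + -(t : ℝ)) / M / δ - 1) = (X i j - (t + 1) / M) / δ - 1 by ring]
        ring
      · intro j' _ hj'
        refine Finset.sum_eq_zero fun t _ => Finset.sum_eq_zero fun r _ => ?_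
        rw [if_neg (Ne.symm hj'), max_eq_right, mul_zero]
        have h1 : δ⁻¹ * X i j ≤ δ⁻¹ * 1 := by
          have := (hX i j).2; gcongr
        have h2 : -(((t : ℕ) : ℝ) + 1) / M / δ ≤ 0 := by
          rw [neg_div, neg_div, neg_nonpos]; positivity
        have h3 : 0 ≤ (![0, 1] : Fin 2 → ℝ) r := by fin_cases r <;> simp
        simp only [B1, one_div]
        linarith
      · simp
    have h2o : ∀ i j, sa (ff1 (Ain * X)) (orr i) j = 0 := by
      intro i j
      simp [sa, h1o, hos]
    have h2s : ∀ j, sa (ff1 (Ain * X)) s j = codeF dx n M δ X := by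
      intro j
      simp only [sa, h1s, h1c, if_true, zero_add, codeF]
    have hcode : codeF dx n M δ X + 1 ≤ B2 := by
      simp only [B2, codeF]
      gcongr with j _ i _
      calc _ ≤ ∑ t : Fin M, (1 : ℝ) := Finset.sum_le_sum fun t _ => (rampF_mem _).2
        _ = M := by simp
    have hN : (Aout * ff2 (sa (ff1 (Ain * X)))) i j = ff2 (sa (ff1 (Ain * X))) (orr i) j := by
      simp [Matrix.mul_apply, Aout]
    change (Aout * ff2 (sa (ff1 (Ain * X)))) i j = _
    rw [hN]
    simp only [ff2, h2o, h2s, hoo, zero_add, Fintype.sum_prod_type]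
    rw [Finset.sum_eq_single j]
    · refine Finset.sum_congr rfl fun a _ => ?_
      simp only [Fin.sum_univ_three, if_true, hatF, Finset.sum_ite_eq, Finset.mem_univ]
      simp
      rw [show codeF dx n M δ X + (-(a : ℝ) + 1) = codeF dx n M δ X - a + 1 by ring,
        show codeF dx n M δ X + -(a : ℝ) = codeF dx n M δ X - a by ring,
        show codeF dx n M δ X + (-(a : ℝ) + -1) = codeF dx n M δ X - a - 1 by ring]
      ring
    · intro j' _ hj'
      refine Finset.sum_eq_zero fun a _ => Finset.sum_eq_zero fun r _ => ?_
      rw [if_neg (Ne.symm hj'), max_eq_right, mul_zero]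
      have h3 : (![1, 0, -1] : Fin 3 → ℝ) r ≤ 1 := by fin_cases r <;> norm_num
      have h4 : (0 : ℝ) ≤ (a : ℕ) := by positivity
      linarith
    · simp

lemma frobNorm_le {d n : ℕ} (A : Matrix (Fin d) (Fin n) ℝ) (c : ℝ) (hc : 0 ≤ c)
    (h : ∀ i j, |A i j| ≤ c) : frobNorm A ≤ (d : ℝ) * n * c := by
  unfold frobNorm
  apply Real.sqrt_le_iff.2
  refine ⟨by positivity, ?_⟩
  have h1 : ∑ i, ∑ j, (A i j) ^ 2 ≤ ∑ i : Fin d, ∑ j : Fin n, c ^ 2 :=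
    Finset.sum_le_sum fun i _ => Finset.sum_le_sum fun j _ => sq_le_sq' (by
      have := abs_le.1 (h i j); linarith) (abs_le.1 (h i j)).2
  refine h1.trans ?_
  simp only [Finset.sum_const, Finset.card_univ, Fintype.card_fin, nsmul_eq_mul]
  have h2 : ((d * n : ℕ) : ℝ) ≤ ((d * n : ℕ) : ℝ) ^ 2 := by
    exact_mod_cast Nat.le_self_pow (by norm_num) _
  push_cast at h2
  have := mul_le_mul_of_nonneg_right h2 (sq_nonneg c)
  nlinarith

lemma frobNorm_nonneg' {d n : ℕ} (A : Matrix (Fin d) (Fin n) ℝ) : 0 ≤ frobNorm A :=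
  Real.sqrt_nonneg _

lemma exists_quant (M : ℕ) (hM : 0 < M) (x : ℝ) (hx : x ∈ Set.Icc (0 : ℝ) 1) :
    ∃ q : Fin M, ((q : ℕ) : ℝ) / M ≤ x ∧ x ≤ (((q : ℕ) : ℝ) + 1) / M := by
  have hM' : (0 : ℝ) < M := by exact_mod_cast hM
  have h0 : 0 ≤ x * M := mul_nonneg hx.1 hM'.le
  by_cases h : x * M < M
  · refine ⟨⟨⌊x * M⌋₊, (Nat.floor_lt h0).2 h⟩, ?_, ?_⟩
    · rw [div_le_iff₀ hM']; exact Nat.floor_le h0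
    · rw [le_div_iff₀ hM']; exact (Nat.lt_floor_add_one _).le
  · refine ⟨⟨M - 1, by omega⟩, ?_, ?_⟩
    · rw [div_le_iff₀ hM']
      push_cast [Nat.cast_sub (show 1 ≤ M from hM)]
      linarith
    · rw [le_div_iff₀ hM']
      push_cast [Nat.cast_sub (show 1 ≤ M from hM)]
      have := mul_le_mul_of_nonneg_right hx.2 hM'.le
      linarith

lemma codeF_good (dx n M : ℕ) (hM : 0 < M) (δ : ℝ) (hδ : 0 < δ)
    (X : Matrix (Fin dx) (Fin n) ℝ) (q : Fin dx → Fin n → Fin M)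
    (hq : ∀ i j, ((q i j : ℕ) : ℝ) / M ≤ X i j ∧ X i j ≤ (((q i j : ℕ) : ℝ) + 1) / M)
    (hg : ∀ i j (t : Fin M), X i j ∉ Set.Icc ((((t : ℕ) : ℝ) + 1) / M)
      ((((t : ℕ) : ℝ) + 1) / M + δ)) :
    codeF dx n M δ X = ((finFunctionFinEquiv (fun e : Fin (dx * n) =>
      q (finProdFinEquiv.symm e).1 (finProdFinEquiv.symm e).2) : Fin (M ^ (dx * n))) : ℕ) := by
  have hM' : (0 : ℝ) < M := by exact_mod_cast hM
  have hr : ∀ i j, ∑ t : Fin M, rampF ((X i j - (((t : ℕ) : ℝ) + 1) / M) / δ) = (q i j : ℕ) := by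
    intro i j
    have h1 : ∀ t : Fin M, rampF ((X i j - (((t : ℕ) : ℝ) + 1) / M) / δ)
        = if t < q i j then 1 else 0 := by
      intro t
      split_ifs with h
      · apply rampF_one
        rw [le_div_iff₀ hδ]
        have h2 : (((t : ℕ) : ℝ) + 1) / M ≤ X i j := by
          refine le_trans ?_ (hq i j).1
          gcongr
          exact_mod_cast h
        by_contra h3
        exact hg i j t ⟨h2, by linarith⟩
      · apply rampF_zero
        apply div_nonpos_of_nonpos_of_nonneg _ hδ.le
        have h2 : (((q i j : ℕ) : ℝ) + 1) / M ≤ (((t : ℕ) : ℝ) + 1) / M := by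
          have : ((q i j : ℕ) : ℝ) ≤ ((t : ℕ) : ℝ) := by
            exact_mod_cast not_lt.1 h
          gcongr
        linarith [(hq i j).2]
    simp only [h1]
    rw [Finset.sum_boole]
    congr 1
    rw [show (Finset.univ.filter fun t => t < q i j) = Finset.Iio (q i j) by ext; simp]
    simp
  simp only [codeF, hr]
  rw [finFunctionFinEquiv_apply, ← finProdFinEquiv.sum_comp, Fintype.sum_prod_type,
    Finset.sum_comm]
  push_cast
  refine Finset.sum_congr rfl fun i _ => Finset.sum_congr rfl fun j _ => ?_
  rw [Equiv.symm_apply_apply, mul_comm]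

lemma int_bound (dx n M : ℕ) (τ : Fin M → ℝ) (δ A C : ℝ) (hδ : 0 ≤ δ)
    (hA : 0 ≤ A) (hC : 0 ≤ C) (f : Matrix (Fin dx) (Fin n) ℝ → ℝ) (hf : ∀ X, 0 ≤ f X)
    (h1 : ∀ X ∈ unitCube dx n, (∀ i j t, X i j ∉ Set.Icc (τ t) (τ t + δ)) → f X ≤ A)
    (h2 : ∀ X ∈ unitCube dx n, f X ≤ C) :
    ∫ X in unitCube dx n, f X ≤ A + C * ((dx : ℝ) * n * M * δ) := by
  classical
  let Box : Fin dx → Fin n → Fin M → Set (Fin dx → Fin n → ℝ) := fun i j t =>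
    Set.pi Set.univ fun i' => Set.pi Set.univ fun j' =>
      if i' = i ∧ j' = j then Set.Icc (τ t) (τ t + δ) else Set.Icc 0 1
  have hBm : ∀ i j t, MeasurableSet (Box i j t) := by
    intro i j t
    refine MeasurableSet.univ_pi fun i' => MeasurableSet.univ_pi fun j' => ?_
    split_ifs <;> exact measurableSet_Icc
  have hBv : ∀ i j t, (volume : Measure (Fin dx → Fin n → ℝ)) (Box i j t)
      = ENNReal.ofReal δ := by
    intro i j t
    simp only [Box]
    rw [volume_pi_pi]
    simp_rw [volume_pi_pi]
    rw [Finset.prod_eq_single i, Finset.prod_eq_single j]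
    · simp
    · intro j' _ hj'; simp [hj']
    · simp
    · intro i' _ hi'; simp [hi']
    · simp
  have hcube : (unitCube dx n : Set (Fin dx → Fin n → ℝ)) =
      Set.pi Set.univ fun i' => Set.pi Set.univ fun j' => Set.Icc (0 : ℝ) 1 := by
    ext X
    exact ⟨fun h i _ j _ => h i j, fun h i j => h i trivial j trivial⟩
  have hcm : MeasurableSet (unitCube dx n : Set (Fin dx → Fin n → ℝ)) := by
    rw [hcube]
    exact MeasurableSet.univ_pi fun i' => MeasurableSet.univ_pi fun j' => measurableSet_Icc
  have hcv : (volume : Measure (Fin dx → Fin n → ℝ)) (unitCube dx n) = 1 := by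
    rw [hcube, volume_pi_pi]
    simp_rw [volume_pi_pi]
    simp
  let μ : Measure (Fin dx → Fin n → ℝ) := volume.restrict (unitCube dx n)
  have : IsProbabilityMeasure μ := ⟨by
    change (volume.restrict (unitCube dx n) : Measure (Fin dx → Fin n → ℝ)) Set.univ = 1
    exact (Measure.restrict_apply_univ _).trans hcv⟩
  change ∫ X, f X ∂μ ≤ _
  let g : (Fin dx → Fin n → ℝ) → ℝ := fun X =>
    A + ∑ i, ∑ j, ∑ t, (Box i j t).indicator (fun _ => C) X
  have hgi : ∀ i j t, Integrable ((Box i j t).indicator (fun _ => C)) μ := fun i j t =>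
    (integrable_const C).indicator (hBm i j t)
  have hg : Integrable g μ := by
    refine (integrable_const A).add ?_
    refine integrable_finsetSum _ fun i _ => integrable_finsetSum _ fun j _ =>
      integrable_finsetSum _ fun t _ => hgi i j t
  have hnn : ∀ i j t (X : Fin dx → Fin n → ℝ), 0 ≤ (Box i j t).indicator (fun _ => C) X :=
    fun i j t X => Set.indicator_nonneg (fun _ _ => hC) X
  have hle : ∫ X, f X ∂μ ≤ ∫ X, g X ∂μ := by
    refine integral_mono_of_nonneg (Filter.Eventually.of_forall hf) hg ?_
    refine ae_restrict_of_forall_mem hcm fun X hX => ?_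
    by_cases hgood : ∀ i j t, X i j ∉ Set.Icc (τ t) (τ t + δ)
    · refine (h1 X hX hgood).trans ?_
      have : 0 ≤ ∑ i, ∑ j, ∑ t, (Box i j t).indicator (fun _ => C) X :=
        Finset.sum_nonneg fun i _ => Finset.sum_nonneg fun j _ => Finset.sum_nonneg fun t _ =>
          hnn i j t X
      simp only [g]; linarith
    · push Not at hgood
      obtain ⟨i, j, t, hb⟩ := hgood
      have hm : X ∈ Box i j t := by
        intro i' _ j' _
        dsimp only
        split_ifs with h
        · rw [h.1, h.2]; exact hb
        · exact hX i' j'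
      have e0 : (Box i j t).indicator (fun _ => C) X = C := Set.indicator_of_mem hm _
      have e1 : C ≤ ∑ t, (Box i j t).indicator (fun _ => C) X := by
        refine e0.symm.le.trans ?_
        exact Finset.single_le_sum (f := fun t => (Box i j t).indicator (fun _ => C) X)
          (fun t _ => hnn i j t X) (Finset.mem_univ t)
      have e2 : C ≤ ∑ j, ∑ t, (Box i j t).indicator (fun _ => C) X :=
        e1.trans (Finset.single_le_sum
          (f := fun j => ∑ t, (Box i j t).indicator (fun _ => C) X)
          (fun j _ => Finset.sum_nonneg fun t _ => hnn i j t X) (Finset.mem_univ j))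
      have e3 : C ≤ ∑ i, ∑ j, ∑ t, (Box i j t).indicator (fun _ => C) X :=
        e2.trans (Finset.single_le_sum
          (f := fun i => ∑ j, ∑ t, (Box i j t).indicator (fun _ => C) X)
          (fun i _ => Finset.sum_nonneg fun j _ => Finset.sum_nonneg fun t _ => hnn i j t X)
          (Finset.mem_univ i))
      have := h2 X hX
      simp only [g]; linarith
  refine hle.trans ?_
  have hI : ∀ i j t, ∫ X, (Box i j t).indicator (fun _ => C) X ∂μ ≤ C * δ := by
    intro i j t
    rw [integral_indicator_const _ (hBm i j t), smul_eq_mul, mul_comm]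
    refine mul_le_mul_of_nonneg_left ?_ hC
    rw [Measure.real]
    refine ENNReal.toReal_le_of_le_ofReal hδ ?_
    rw [← hBv i j t]
    exact Measure.restrict_apply_le _ _
  simp only [g]
  rw [integral_add (integrable_const A)
    (integrable_finsetSum _ fun i _ => integrable_finsetSum _ fun j _ =>
      integrable_finsetSum _ fun t _ => hgi i j t)]
  rw [integral_finsetSum _ fun i _ => integrable_finsetSum _ fun j _ =>
      integrable_finsetSum _ fun t _ => hgi i j t]
  simp only [integral_const, probReal_univ, one_smul]
  gcongr
  calc _ ≤ ∑ i : Fin dx, ∑ j : Fin n, ∑ t : Fin M, C * δ := by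
        refine Finset.sum_le_sum fun i _ => ?_
        rw [integral_finsetSum _ fun j _ => integrable_finsetSum _ fun t _ => hgi i j t]
        refine Finset.sum_le_sum fun j _ => ?_
        rw [integral_finsetSum _ fun t _ => hgi i j t]
        exact Finset.sum_le_sum fun t _ => hI i j t
    _ = _ := by simp; ring

/-- Theorem 8: approximation of entrywise `γ`-Hölder sequence-to-sequence
functions by generalized transformer networks in the `L^p` norm. -/
theorem genTransformer_holder_approx
    (dx n : ℕ) (hdx : 0 < dx) (hn : 0 < n) (γ KH p ε : ℝ)
    (hγ : γ ∈ Set.Ioc (0 : ℝ) 1) (hKH : 0 < KH) (hp : 1 ≤ p) (hε : ε ∈ Set.Ioo (0 : ℝ) 1)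
    (F : Matrix (Fin dx) (Fin n) ℝ → Matrix (Fin dx) (Fin n) ℝ)
    (hF : ∀ i j, HolderClass γ KH (unitCube dx n) (fun X => F X i j)) :
    ∃ N : Matrix (Fin dx) (Fin n) ℝ → Matrix (Fin dx) (Fin n) ℝ,
      IsGenTransformer n dx (4 * dx * n) dx (3 * dx * n * ⌈ε ^ (-((dx : ℝ) * n) / γ)⌉₊)
        (6 * ⌈(1 / γ) * Real.logb 2 (1 / ε)⌉₊) N ∧
      lpNormCube p (fun X => N X - F X) ≤ 4 * ((dx : ℝ) * n) ^ 3 * KH * ε := by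
  classical
  obtain ⟨hγ0, hγ1⟩ := hγ
  obtain ⟨hε0, hε1⟩ := hε
  set m : ℝ := (dx : ℝ) * n with hm
  have hm1 : 1 ≤ m := by
    have : 1 ≤ dx * n := Nat.mul_pos hdx hn
    rw [hm]; exact_mod_cast this
  -- the resolution
  set y : ℝ := ε ^ (-(1 / γ)) with hy
  have hy1 : 1 ≤ y := Real.one_le_rpow_of_pos_of_le_one_of_nonpos hε0 hε1.le
    (by rw [neg_nonpos]; positivity)
  have hyinv : y⁻¹ = ε ^ (1 / γ) := by
    rw [hy, Real.rpow_neg hε0.le, inv_inv]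
  set M : ℕ := ⌊y⌋₊ with hMdef
  have hM : 0 < M := Nat.floor_pos.2 hy1
  have hM' : (0 : ℝ) < M := by exact_mod_cast hM
  have hMy : (M : ℝ) ≤ y := Nat.floor_le (by linarith)
  have hM1 : (1 : ℝ) ≤ M := by exact_mod_cast hM
  have hyM : y ≤ 2 * M := by
    have := Nat.lt_floor_add_one y
    linarith
  have hMinv : 1 / (M : ℝ) ≤ 2 * ε ^ (1 / γ) := by
    rw [← hyinv, ← div_eq_mul_inv, div_le_div_iff₀ hM' (by linarith)]
    linarith
  set T : ℕ := ⌈ε ^ (-m / γ)⌉₊ with hT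
  have hMT : M ^ (dx * n) ≤ T := by
    have h1 : (M : ℝ) ^ (dx * n) ≤ ε ^ (-m / γ) := by
      calc (M : ℝ) ^ (dx * n) ≤ y ^ (dx * n) := by gcongr
        _ = ε ^ (-m / γ) := by
          rw [hy, ← Real.rpow_natCast, ← Real.rpow_mul hε0.le]
          congr 1
          rw [hm]; push_cast; ring
    exact_mod_cast h1.trans (Nat.le_ceil _)
  have hMT' : M ≤ T := (Nat.le_self_pow (Nat.mul_pos hdx hn).ne' M).trans hMT
  have hL : 2 ≤ 6 * ⌈(1 / γ) * Real.logb 2 (1 / ε)⌉₊ := by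
    have : 0 < ⌈(1 / γ) * Real.logb 2 (1 / ε)⌉₊ := by
      apply Nat.ceil_pos.2
      have : 0 < Real.logb 2 (1 / ε) :=
        Real.logb_pos (by norm_num) (by rw [lt_div_iff₀ hε0]; linarith)
      positivity
    omega
  have hD : 2 * dx + 2 ≤ 4 * dx * n := by
    have : 4 * dx * 1 ≤ 4 * dx * n := Nat.mul_le_mul_left _ hn
    omega
  have hW1 : 2 * dx * n * M ≤ 3 * dx * n * T := by
    gcongr; norm_num
  have hW2 : 3 * n * M ^ (dx * n) ≤ 3 * dx * n * T := by
    gcongr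
    omega
  -- the error levels
  set A : ℝ := 2 * m ^ 2 * KH * ε with hA
  set R : ℝ := 4 * m ^ 3 * KH * ε with hR
  set C : ℝ := m * (((M : ℝ) ^ (dx * n) + 1) * KH) with hC
  have hA0 : 0 ≤ A := by positivity
  have hC0 : 0 ≤ C := by positivity
  have hR0 : 0 < R := by positivity
  have hAR : A < R := by
    have h1 : m ^ 2 ≤ m ^ 3 := pow_le_pow_right₀ hm1 (by norm_num)
    have h2 : 0 < m ^ 3 := by positivity
    have h3 : 0 < KH * ε := by positivity
    have : 2 * m ^ 2 * (KH * ε) < 4 * m ^ 3 * (KH * ε) :=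
      mul_lt_mul_of_pos_right (by linarith) h3
    rw [hA, hR]; linarith
  have hp0 : 0 < p := by linarith
  have hARp : A ^ p < R ^ p := Real.rpow_lt_rpow hA0 hAR hp0
  have hCp : 0 ≤ C ^ p := Real.rpow_nonneg hC0 p
  set δ : ℝ := (R ^ p - A ^ p) / ((C ^ p + 1) * (m * M)) with hδdef
  have hδ : 0 < δ := by
    have : 0 < R ^ p - A ^ p := by linarith
    positivity
  have hδ2 : C ^ p * (m * M * δ) ≤ R ^ p - A ^ p := by
    have e : m * M * δ = (R ^ p - A ^ p) / (C ^ p + 1) := by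
      rw [hδdef]; field_simp
    rw [e, mul_div_assoc', div_le_iff₀ (by positivity)]
    have : 0 < R ^ p - A ^ p := by linarith
    nlinarith
  let Y : Fin (M ^ (dx * n)) → Matrix (Fin dx) (Fin n) ℝ := fun a => Matrix.of fun i j =>
    (((finFunctionFinEquiv.symm a (finProdFinEquiv (i, j)) : Fin M) : ℕ) : ℝ) / M
  have hY : ∀ a, Y a ∈ unitCube dx n := by
    intro a i j
    refine ⟨by simp only [Y, Matrix.of_apply]; positivity, ?_⟩
    simp only [Y, Matrix.of_apply]
    rw [div_le_one hM']
    exact_mod_cast (Fin.is_lt _).le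
  obtain ⟨N, hN, hNX⟩ := net_form dx n (4 * dx * n) (3 * dx * n * T) _ M hdx hn hD hL hW1 hW2 δ hδ
    (fun a i j => F (Y a) i j)
  refine ⟨N, hN, ?_⟩
  have hFb : ∀ X ∈ unitCube dx n, ∀ i j, |F X i j| ≤ KH := by
    intro X hX i j
    obtain ⟨C1, C2, h1, h2, h3, h4, h5⟩ := hF i j
    exact (h4 X hX).trans (by linarith)
  have hbound : ∀ X ∈ unitCube dx n, frobNorm (N X - F X) ≤ C := by
    intro X hX
    refine frobNorm_le _ _ (by positivity) fun i j => ?_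
    rw [Matrix.sub_apply]
    refine (abs_sub _ _).trans ?_
    have h1 : |N X i j| ≤ (M : ℝ) ^ (dx * n) * KH := by
      rw [hNX X hX]
      refine (Finset.abs_sum_le_sum_abs _ _).trans ?_
      calc _ ≤ ∑ a : Fin (M ^ (dx * n)), KH := by
            refine Finset.sum_le_sum fun a _ => ?_
            rw [abs_mul]
            obtain ⟨g1, g2⟩ := hatF_mem (codeF dx n M δ X - (a : ℕ))
            rw [abs_of_nonneg g1]
            exact (mul_le_of_le_one_right (abs_nonneg _) g2).trans (hFb _ (hY a) i j)
        _ = _ := by simp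
    have := hFb X hX i j
    linarith
  have hgood : ∀ X ∈ unitCube dx n, (∀ i j (t : Fin M), X i j ∉
      Set.Icc ((((t : ℕ) : ℝ) + 1) / M) ((((t : ℕ) : ℝ) + 1) / M + δ)) →
      frobNorm (N X - F X) ≤ A := by
    intro X hX hg
    choose q hq using fun i j => exists_quant M hM (X i j) (hX i j)
    have hcode := codeF_good dx n M hM δ hδ X q hq hg
    set a : Fin (M ^ (dx * n)) := finFunctionFinEquiv (fun e : Fin (dx * n) =>
      q (finProdFinEquiv.symm e).1 (finProdFinEquiv.symm e).2) with ha
    have hYa : ∀ i j, Y a i j = ((q i j : ℕ) : ℝ) / M := by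
      intro i j
      simp only [Y, Matrix.of_apply, ha]
      rw [Equiv.symm_apply_apply, Equiv.symm_apply_apply]
    have hNa : ∀ i j, N X i j = F (Y a) i j := by
      intro i j
      rw [hNX X hX, hcode]
      simp only [hatF_nat]
      rw [Finset.sum_eq_single a]
      · simp
      · intro b _ hb
        have : (a : ℕ) ≠ b := fun h => hb (Fin.ext h.symm)
        simp [this]
      · simp
    have hdist : frobNorm (Y a - X) ≤ m * (2 * ε ^ (1 / γ)) := by
      refine frobNorm_le _ _ (by positivity) fun i j => ?_
      rw [Matrix.sub_apply, hYa]
      obtain ⟨g1, g2⟩ := hq i j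
      rw [add_div] at g2
      rw [abs_le]; constructor <;> linarith [show 0 ≤ 1 / (M : ℝ) by positivity]
    have hdist2 : frobNorm (Y a - X) ^ γ ≤ 2 * m * ε := by
      calc _ ≤ (m * (2 * ε ^ (1 / γ))) ^ γ :=
            Real.rpow_le_rpow (frobNorm_nonneg' _) hdist hγ0.le
        _ = (2 * m) ^ γ * ε := by
            rw [show m * (2 * ε ^ (1 / γ)) = (2 * m) * ε ^ (1 / γ) by ring,
              Real.mul_rpow (by positivity) (by positivity), ← Real.rpow_mul hε0.le,
              one_div_mul_cancel hγ0.ne', Real.rpow_one]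
        _ ≤ 2 * m * ε := by
            gcongr
            calc (2 * m) ^ γ ≤ (2 * m) ^ (1 : ℝ) :=
                  Real.rpow_le_rpow_of_exponent_le (by linarith) hγ1
              _ = 2 * m := Real.rpow_one _
    have := frobNorm_le (N X - F X) (KH * (2 * m * ε)) (by positivity) fun i j => by
      rw [Matrix.sub_apply, hNa]
      obtain ⟨C1, C2, h1, h2, h3, h4, h5⟩ := hF i j
      refine (h5 _ (hY a) X hX).trans ?_
      have : C2 ≤ KH := by linarith
      have := Real.rpow_nonneg (frobNorm_nonneg' (Y a - X)) γ
      gcongr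
    refine this.trans (le_of_eq ?_)
    rw [hA]; ring
  have hint := int_bound dx n M (fun t => (((t : ℕ) : ℝ) + 1) / M) δ (A ^ p) (C ^ p) hδ.le
    (Real.rpow_nonneg hA0 p) hCp (fun X => frobNorm (N X - F X) ^ p)
    (fun X => Real.rpow_nonneg (frobNorm_nonneg' _) p)
    (fun X hX hg => Real.rpow_le_rpow (frobNorm_nonneg' _) (hgood X hX hg) hp0.le)
    (fun X hX => Real.rpow_le_rpow (frobNorm_nonneg' _) (hbound X hX) hp0.le)
  unfold lpNormCube
  have hI0 : 0 ≤ ∫ X in unitCube dx n, frobNorm (N X - F X) ^ p :=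
    integral_nonneg fun X => Real.rpow_nonneg (frobNorm_nonneg' _) p
  calc _ ≤ (R ^ p) ^ (1 / p) := by
        refine Real.rpow_le_rpow hI0 (hint.trans ?_) (by positivity)
        linarith
    _ = R := by
        rw [← Real.rpow_mul hR0.le, mul_one_div_cancel hp0.ne', Real.rpow_one]
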